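/- Corollary 1 (improving splits are far away): let D be a dataset, d ≥ 1, f : Fin p a feature, τ a threshold with θ_τ = Split(D, d, f, τ), and UB a natural number with UB ≤ θ_τ. If a threshold τ' is improving, i.e., Split(D, d, f, τ') < UB, then |z_f(τ) − z_f(τ')| ≥ 1 and (|z_f(τ) − z_f(τ')| : ℤ) > θ_τ − UB; equivalently, |z_f(τ) − z_f(τ')| ≥ max(1, θ_τ − UB + 1). -/

import Mathlib

open scoped Classical

/-- A binary axis-aligned decision tree over `p` features with labels in `Y`:
either a leaf carrying a label, or a node carrying a feature, a threshold,
and two subtrees. -/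
inductive DTree (p : ℕ) (Y : Type) : Type
  | leaf (lab : Y) : DTree p Y
  | node (f : Fin p) (τ : ℝ) (l r : DTree p Y) : DTree p Y

namespace DTree

/-- A leaf classifies every `x` as its label; a node classifies `x` by the left
subtree if `x f ≤ τ` and by the right subtree otherwise. -/
noncomputable def classify {p : ℕ} {Y : Type} : DTree p Y → (Fin p → ℝ) → Y
  | leaf lab, _ => lab
  | node f τ l r, x => if x f ≤ τ then l.classify x else r.classify x

/-- The depth of a leaf is 0; the depth of a node is 1 plus the maximum of the
depths of its subtrees. -/
def depth {p : ℕ} {Y : Type} : DTree p Y → ℕ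
  | leaf _ => 0
  | node _ _ l r => 1 + max l.depth r.depth

end DTree

/-- `errors t D` is the number of observations of `D` misclassified by `t`. -/
noncomputable def errors {p : ℕ} {Y : Type} (t : DTree p Y)
    (D : Multiset ((Fin p → ℝ) × Y)) : ℕ :=
  (D.map fun xy => if t.classify xy.1 = xy.2 then 0 else 1).sum

/-- `theta D d`: the optimal misclassification score, i.e. the minimum of
`errors t D` over all decision trees `t` of depth at most `d`. -/
noncomputable def theta {p : ℕ} {Y : Type} (D : Multiset ((Fin p → ℝ) × Y))
    (d : ℕ) : ℕ :=
  sInf {n | ∃ t : DTree p Y, t.depth ≤ d ∧ errors t D = n}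

/-- `dle D f τ = D(f ≤ τ)`: the sub-multiset of observations with `x f ≤ τ`. -/
noncomputable def dle {p : ℕ} {Y : Type} (D : Multiset ((Fin p → ℝ) × Y))
    (f : Fin p) (τ : ℝ) : Multiset ((Fin p → ℝ) × Y) :=
  D.filter fun xy => xy.1 f ≤ τ

/-- `dgt D f τ = D(f > τ)`: the sub-multiset of observations with `x f > τ`. -/
noncomputable def dgt {p : ℕ} {Y : Type} (D : Multiset ((Fin p → ℝ) × Y))
    (f : Fin p) (τ : ℝ) : Multiset ((Fin p → ℝ) × Y) :=
  D.filter fun xy => τ < xy.1 f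

/-- `zf D f τ = z_f(τ) := card(D(f ≤ τ))`. -/
noncomputable def zf {p : ℕ} {Y : Type} (D : Multiset ((Fin p → ℝ) × Y))
    (f : Fin p) (τ : ℝ) : ℕ :=
  (dle D f τ).card

/-- `splitScore D d f τ = Split(D, d, f, τ) := θ(D(f ≤ τ), d−1) + θ(D(f > τ), d−1)`. -/
noncomputable def splitScore {p : ℕ} {Y : Type} (D : Multiset ((Fin p → ℝ) × Y))
    (d : ℕ) (f : Fin p) (τ : ℝ) : ℕ :=
  theta (dle D f τ) (d - 1) + theta (dgt D f τ) (d - 1)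

/-- The multiset of values of feature `f` in `D`. -/
noncomputable def featureVals {p : ℕ} {Y : Type} (D : Multiset ((Fin p → ℝ) × Y))
    (f : Fin p) : Multiset ℝ :=
  D.map fun xy => xy.1 f

/-- `midpoints D f = S^f`: the set of midpoints `(a + b) / 2` over all pairs
`a < b` of consecutive distinct values of feature `f` in `D` (i.e. no feature
value lies strictly between `a` and `b`). -/
noncomputable def midpoints {p : ℕ} {Y : Type} (D : Multiset ((Fin p → ℝ) × Y))
    (f : Fin p) : Set ℝ :=
  {m | ∃ a b : ℝ, a ∈ featureVals D f ∧ b ∈ featureVals D f ∧ a < b ∧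
    (∀ c ∈ featureVals D f, ¬(a < c ∧ c < b)) ∧ m = (a + b) / 2}

/-- `leafScore D = L(D)`: the best leaf score, the minimum over labels `ŷ` of
the number of observations of `D` whose label differs from `ŷ`. -/
noncomputable def leafScore {p : ℕ} {Y : Type} (D : Multiset ((Fin p → ℝ) × Y)) : ℕ :=
  sInf {n | ∃ lab : Y, n = (D.map fun xy => if xy.2 = lab then 0 else 1).sum}

theorem errors_add {p : ℕ} {Y : Type} (t : DTree p Y) (A B : Multiset ((Fin p → ℝ) × Y)) :
    errors t (A + B) = errors t A + errors t B := by
  simp [errors]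

theorem errors_le_card {p : ℕ} {Y : Type} (t : DTree p Y) (A : Multiset ((Fin p → ℝ) × Y)) :
    errors t A ≤ A.card := by
  refine (Multiset.sum_le_card_nsmul _ 1 ?_).trans_eq (by simp)
  intro n hn
  obtain ⟨a, -, rfl⟩ := Multiset.mem_map.mp hn
  split_ifs <;> simp

theorem theta_le_errors {p : ℕ} {Y : Type} {t : DTree p Y} {d : ℕ} (ht : t.depth ≤ d)
    (A : Multiset ((Fin p → ℝ) × Y)) : theta A d ≤ errors t A :=
  Nat.sInf_le ⟨t, ht, rfl⟩

theorem exists_errors_eq_theta {p : ℕ} {Y : Type} [Nonempty Y]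
    (A : Multiset ((Fin p → ℝ) × Y)) (d : ℕ) :
    ∃ t : DTree p Y, t.depth ≤ d ∧ errors t A = theta A d :=
  Nat.sInf_mem (s := {n | ∃ t : DTree p Y, t.depth ≤ d ∧ errors t A = n})
    ⟨_, .leaf (Classical.arbitrary Y), Nat.zero_le d, rfl⟩

theorem theta_le_theta_add {p : ℕ} {Y : Type} [Nonempty Y]
    (A B : Multiset ((Fin p → ℝ) × Y)) (d : ℕ) : theta A d ≤ theta (A + B) d := by
  obtain ⟨t, ht, h⟩ := exists_errors_eq_theta (A + B) d
  have := theta_le_errors ht A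
  rw [errors_add] at h
  omega

theorem theta_add_le {p : ℕ} {Y : Type} [Nonempty Y]
    (A B : Multiset ((Fin p → ℝ) × Y)) (d : ℕ) : theta (A + B) d ≤ theta A d + B.card := by
  obtain ⟨t, ht, h⟩ := exists_errors_eq_theta A d
  have h₁ := theta_le_errors ht (A + B)
  have h₂ := errors_le_card t B
  rw [errors_add] at h₁
  omega

theorem exists_dle_dgt_add {p : ℕ} {Y : Type} (D : Multiset ((Fin p → ℝ) × Y)) (f : Fin p)
    {a b : ℝ} (hab : a ≤ b) :
    ∃ M, dle D f b = dle D f a + M ∧ dgt D f a = dgt D f b + M := by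
  have hle : dle D f a ≤ dle D f b :=
    Multiset.monotone_filter_right D fun _ h => h.trans hab
  obtain ⟨M, hM⟩ := Multiset.le_iff_exists_add.mp hle
  refine ⟨M, hM, ?_⟩
  have hsplit (c : ℝ) : dle D f c + dgt D f c = D := by
    simpa only [dle, dgt, not_le] using
      Multiset.filter_add_not (fun xy : (Fin p → ℝ) × Y => xy.1 f ≤ c) D
  have h := (hsplit a).trans (hsplit b).symm
  rw [hM, add_assoc] at h
  rw [add_left_cancel h, add_comm]

theorem splitScore_le_add_abs {p : ℕ} {Y : Type} [Nonempty Y]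
    (D : Multiset ((Fin p → ℝ) × Y)) (d : ℕ) (f : Fin p) (τ τ' : ℝ) :
    (splitScore D d f τ : ℤ) ≤ splitScore D d f τ' + |(zf D f τ : ℤ) - (zf D f τ' : ℤ)| := by
  unfold splitScore zf
  rcases le_total τ τ' with hτ | hτ <;> obtain ⟨M, h₁, h₂⟩ := exists_dle_dgt_add D f hτ
  · have h₃ := theta_le_theta_add (dle D f τ) M (d - 1)
    have h₄ := theta_add_le (dgt D f τ') M (d - 1)
    rw [h₁, h₂, Multiset.card_add]
    grind
  · have h₃ := theta_add_le (dle D f τ') M (d - 1)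
    have h₄ := theta_le_theta_add (dgt D f τ) M (d - 1)
    rw [h₁, h₂, Multiset.card_add]
    grind

/-- Corollary 1 (improving splits are far away): with `UB ≤ θ_τ`, if
`Split(D, d, f, τ') < UB` then `|z_f(τ) − z_f(τ')| ≥ 1` and
`|z_f(τ) − z_f(τ')| > θ_τ − UB`; equivalently
`|z_f(τ) − z_f(τ')| ≥ max(1, θ_τ − UB + 1)`. -/
theorem improving_splits_far {p : ℕ} {Y : Type} [Fintype Y] [Nonempty Y]
    (D : Multiset ((Fin p → ℝ) × Y)) (d : ℕ) (hd : 1 ≤ d) (f : Fin p)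
    (τ τ' : ℝ) (UB : ℕ) (hUB : UB ≤ splitScore D d f τ)
    (h : splitScore D d f τ' < UB) :
    1 ≤ |(zf D f τ : ℤ) - (zf D f τ' : ℤ)| ∧
    (splitScore D d f τ : ℤ) - (UB : ℤ) < |(zf D f τ : ℤ) - (zf D f τ' : ℤ)| ∧
    max 1 ((splitScore D d f τ : ℤ) - (UB : ℤ) + 1) ≤
      |(zf D f τ : ℤ) - (zf D f τ' : ℤ)| := by
  have := splitScore_le_add_abs D d f τ τ'
  omega
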